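/- Let N, n, k be integers with 1 ≤ k ≤ n ≤ N, let a_1, ..., a_L ∈ ZMod N, and set S_i = arc(a_i, n) for i = 1, ..., L. Suppose that for a nonempty index set T ⊆ {1, ..., L} there exist pairwise disjoint subsets S'_i ⊆ S_i (i ∈ T) with |S'_i| = k. Then there exist a nonempty index set T' ⊆ {1, ..., L} with |T'| = |T| and pairwise disjoint subsets S''_i ⊆ S_i (i ∈ T') with |S''_i| = k such that every S''_i is a cyclic arc of length k contained in S_i, and at least one index i_0 ∈ T' satisfies S''_{i_0} = arc(a_{i_0}, k), i.e., packet i_0 is assigned the first k MUs of its arc. -/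

import Mathlib

/-- The cyclic arc of length `m` starting at `a` in `ZMod N`. -/
def arc (N : ℕ) (a : ZMod N) (m : ℕ) : Finset (ZMod N) :=
  (Finset.range m).image (fun i : ℕ => (a + (i : ZMod N) : ZMod N))

theorem mem_arc {N : ℕ} {a x : ZMod N} {m : ℕ} :
    x ∈ arc N a m ↔ ∃ i < m, a + (i : ZMod N) = x := by
  simp [arc]

/-- First-come-first-served schedule on the integers for a periodic sequence `c` of release
times and jobs of length `k`: every job starts as early as its predecessors permit. -/
theorem exists_periodic_schedule {m k : ℕ} {N n : ℤ} (hm : 0 < m) (c : ℤ → ℤ)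
    (hc : ∀ j q, c (j + m * q) = c j + N * q) (hmk : (m : ℤ) * k ≤ N)
    (hall : ∀ j, ∀ d < m, c (j - (d : ℕ)) + (d + 1) * k ≤ c j + n) :
    ∃ b : ℤ → ℤ, (∀ j, c j ≤ b j) ∧ (∀ j, b j + k ≤ c j + n) ∧
      (∀ j (d : ℕ), b j + d * k ≤ b (j + d)) ∧
      (∀ j q, b (j + m * q) = b j + N * q) ∧ ∃ j, b j = c j := by
  have hne : (Finset.range m).Nonempty := ⟨0, by simpa using hm⟩
  let b : ℤ → ℤ := fun j => (Finset.range m).sup' hne fun d => c (j - (d : ℕ)) + d * k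
  have hle : ∀ j, ∀ d < m, c (j - (d : ℕ)) + d * k ≤ b j := fun j d hd =>
    Finset.le_sup' (fun d : ℕ => c (j - (d : ℕ)) + d * k) (Finset.mem_range.2 hd)
  have hex : ∀ j, ∃ d < m, b j = c (j - (d : ℕ)) + d * k := fun j => by
    obtain ⟨d, hd, h⟩ := Finset.exists_mem_eq_sup' hne fun d : ℕ => c (j - (d : ℕ)) + d * k
    exact ⟨d, Finset.mem_range.1 hd, h⟩
  clear_value b
  have hcb : ∀ j, c j ≤ b j := fun j => by simpa using hle j 0 hm
  have hsucc : ∀ j, b j + k ≤ b (j + 1) := fun j => by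
    obtain ⟨d, hd, h⟩ := hex j
    rcases Nat.lt_or_ge (d + 1) m with hd' | hd'
    · have := hle (j + 1) (d + 1) hd'
      rw [show j + 1 - ((d + 1 : ℕ) : ℤ) = j - d by push_cast; ring] at this
      push_cast at this
      linarith
    · obtain rfl : m = d + 1 := by omega
      have h1 := hc (j - d) 1
      rw [show j - d + ((d + 1 : ℕ) : ℤ) * 1 = j + 1 by push_cast; ring] at h1
      have h2 := hcb (j + 1)
      push_cast at hmk
      linarith
  have hchain : ∀ j (d : ℕ), b j + d * k ≤ b (j + d) := fun j d => by
    induction d with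
    | zero => simp
    | succ d ih =>
      have := hsucc (j + d)
      push_cast
      rw [← add_assoc]
      linarith
  have hper : ∀ j q, b (j + m * q) ≤ b j + N * q := fun j q => by
    obtain ⟨d, hd, h⟩ := hex (j + m * q)
    have h1 := hle j d hd
    rw [show j + m * q - (d : ℤ) = j - d + m * q by ring, hc] at h
    linarith
  refine ⟨b, hcb, fun j => ?_, hchain, fun j q => le_antisymm (hper j q) ?_, ?_⟩
  · obtain ⟨d, hd, h⟩ := hex j
    have := hall j d hd
    linarith
  · have := hper (j + m * q) (-q)
    rw [show j + m * q + m * -q = j by ring] at this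
    linarith
  · obtain ⟨d, hd, h⟩ := hex 0
    refine ⟨0 - d, le_antisymm ?_ (hcb _)⟩
    have := hchain (0 - d) d
    rw [sub_add_cancel] at this
    linarith

/-- Sorting finitely many residues and repeating them with period `N` gives a monotone
integer sequence. -/
theorem exists_periodic_lift {ι : Type*} {N : ℕ} [NeZero N] (a : ι → ZMod N) (T : Finset ι)
    (hT : T.Nonempty) :
    ∃ (c : ℤ → ℤ) (e : ℤ → ι), Monotone c ∧ (∀ j q, c (j + T.card * q) = c j + N * q) ∧
      (∀ j, (c j : ZMod N) = a (e j)) ∧ (∀ j, e j ∈ T) ∧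
      (∀ i ∈ T, ∃ j : ℤ, 0 ≤ j ∧ j < T.card ∧ e j = i) ∧
      (∀ i j, e i = e j → (T.card : ℤ) ∣ i - j) := by
  have hm : 0 < T.card := hT.card_pos
  set m := T.card
  let e₀ : Fin m ≃ T := T.equivFin.symm
  let f : Fin m → ℕ := fun i => (a (e₀ i)).val
  let s : Fin m ≃ T := (Tuple.sort f).trans e₀
  have hs : Monotone fun i => (a (s i)).val := Tuple.monotone_sort f
  clear_value s
  have hm' : (0 : ℤ) < m := by exact_mod_cast hm
  have hm0 : (m : ℤ) ≠ 0 := hm'.ne'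
  let r : ℤ → Fin m := fun j => ⟨(j % m).toNat, by
    have := Int.emod_lt_of_pos j hm'
    have := Int.emod_nonneg j hm0
    omega⟩
  have hrv : ∀ j, ((r j : ℕ) : ℤ) = j % m := fun j => Int.toNat_of_nonneg (Int.emod_nonneg j hm0)
  have hr : ∀ j q, r (j + m * q) = r j := fun j q => by simp [r]
  clear_value r
  refine ⟨fun j => ((a (s (r j))).val : ℤ) + N * (j / m), fun j => s (r j), ?_, ?_, ?_, ?_, ?_,
    ?_⟩
  · intro i j hij
    have hdiv : i / m ≤ j / m := Int.ediv_le_ediv hm' hij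
    rcases hdiv.eq_or_lt with h | h
    · have hrr : r i ≤ r j := by
        have h1 := Int.emod_add_mul_ediv i m
        have h2 := Int.emod_add_mul_ediv j m
        have h3 := hrv i
        have h4 := hrv j
        rw [Fin.le_def]
        rw [h] at h1
        omega
      have := hs hrr
      dsimp only at this ⊢
      rw [h]
      omega
    · have h1 := ZMod.val_lt (a (s (r i)))
      have h2 : (N : ℤ) * (i / m + 1) ≤ N * (j / m) :=
        mul_le_mul_of_nonneg_left h (Int.natCast_nonneg N)
      dsimp only
      rw [mul_add] at h2
      omega
  · intro j q
    dsimp only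
    rw [hr, Int.add_mul_ediv_left _ _ hm0]
    ring
  · intro j
    simp
  · intro j
    exact (s (r j)).2
  · intro i hi
    refine ⟨(s.symm ⟨i, hi⟩ : Fin m), by positivity, by exact_mod_cast (s.symm ⟨i, hi⟩).2, ?_⟩
    have : r ((s.symm ⟨i, hi⟩ : Fin m) : ℕ) = s.symm ⟨i, hi⟩ := by
      apply Fin.ext
      have := hrv ((s.symm ⟨i, hi⟩ : Fin m) : ℕ)
      rw [Int.emod_eq_of_lt (by positivity) (by exact_mod_cast (s.symm ⟨i, hi⟩).2)] at this
      exact_mod_cast this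
    simp [this]
  · intro i j h
    have hrr : r i = r j := s.injective (Subtype.ext h)
    apply Int.ModEq.dvd
    rw [Int.ModEq, ← hrv, ← hrv, hrr]

/-- Key claim in the optimality proof of the cyclic read algorithm: there is a solution of
the same size consisting of cyclic-consecutive assignments, in which some packet is
assigned the first `k` MUs of its arc. -/
theorem cyclic_solution_with_first_k
    {N n k L : ℕ} (hk : 1 ≤ k) (hkn : k ≤ n) (hnN : n ≤ N)
    (a : Fin L → ZMod N) (T : Finset (Fin L)) (hT : T.Nonempty)
    (S' : Fin L → Finset (ZMod N))
    (hsub : ∀ i ∈ T, S' i ⊆ arc N (a i) n)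
    (hcard : ∀ i ∈ T, (S' i).card = k)
    (hdisj : ∀ i ∈ T, ∀ j ∈ T, i ≠ j → Disjoint (S' i) (S' j)) :
    ∃ T' : Finset (Fin L), T'.Nonempty ∧ T'.card = T.card ∧
      ∃ b : Fin L → ZMod N,
        (∀ i ∈ T', arc N (b i) k ⊆ arc N (a i) n) ∧
        (∀ i ∈ T', ∀ j ∈ T', i ≠ j → Disjoint (arc N (b i) k) (arc N (b j) k)) ∧
        ∃ i₀ ∈ T', arc N (b i₀) k = arc N (a i₀) k := by
  have : NeZero N := ⟨by omega⟩
  obtain ⟨c, e, hmono, hc, hca, heT, hsurj, hinj⟩ := exists_periodic_lift a T hT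
  have hm : 0 < T.card := hT.card_pos
  have hmk : (T.card : ℤ) * k ≤ N := by
    have h := Finset.card_biUnion hdisj
    rw [Finset.sum_congr rfl hcard, Finset.sum_const, smul_eq_mul] at h
    have h' := Finset.card_le_univ (T.biUnion S')
    rw [ZMod.card, h] at h'
    exact_mod_cast h'
  have hall : ∀ j, ∀ d < T.card, c (j - (d : ℕ)) + (d + 1) * k ≤ c j + (n : ℤ) := by
    intro j d hd
    let I := Finset.Icc (j - d) j
    have hdj : (I : Set ℤ).PairwiseDisjoint fun t => S' (e t) := by
      intro x hx y hy hxy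
      refine hdisj _ (heT x) _ (heT y) fun h => hxy ?_
      simp only [I, Finset.coe_Icc, Set.mem_Icc] at hx hy
      have := Int.eq_zero_of_abs_lt_dvd (hinj x y h) (by rw [abs_lt]; omega)
      omega
    have hU := Finset.card_biUnion hdj
    rw [Finset.sum_congr rfl fun t _ => hcard (e t) (heT t), Finset.sum_const, smul_eq_mul,
      Int.card_Icc] at hU
    have hsubset : I.biUnion (fun t => S' (e t)) ⊆
        (Finset.Ico (c (j - d)) (c j + n)).image (Int.cast : ℤ → ZMod N) := by
      intro x hx
      obtain ⟨t, ht, hx⟩ := Finset.mem_biUnion.1 hx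
      obtain ⟨u, hu, rfl⟩ := mem_arc.1 (hsub _ (heT t) hx)
      have ht := Finset.mem_Icc.1 ht
      have h1 := hmono ht.1
      have h2 := hmono ht.2
      refine Finset.mem_image.2 ⟨c t + u, Finset.mem_Ico.2 (by omega), ?_⟩
      simp [hca]
    have h := (Finset.card_le_card hsubset).trans Finset.card_image_le
    rw [hU, Int.card_Ico] at h
    have h1 : c (j - d) ≤ c j := hmono (by omega)
    rw [show (j + 1 - (j - (d : ℤ))).toNat = d + 1 by omega] at h
    zify at h
    rw [Int.toNat_of_nonneg (by omega)] at h
    linarith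
  obtain ⟨b, hcb, hbn, hchain, hbper, j₀, hj₀⟩ := exists_periodic_schedule hm c hc hmk hall
  choose! p hp0 hpm hpe using hsurj
  refine ⟨T, hT, rfl, fun i => b (p i), ?_, ?_, e j₀, heT j₀, ?_⟩
  · intro i hi x hx
    obtain ⟨u, hu, rfl⟩ := mem_arc.1 hx
    have h1 := hcb (p i)
    have h2 := hbn (p i)
    refine mem_arc.2 ⟨(b (p i) - c (p i) + u).toNat, by omega, ?_⟩
    rw [← Int.cast_natCast (R := ZMod N), Int.toNat_of_nonneg (by omega)]
    push_cast
    rw [hca, hpe i hi]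
    ring
  · have key : ∀ i ∈ T, ∀ j ∈ T, p i < p j →
        Disjoint (arc N (b (p i)) k) (arc N (b (p j)) k) := by
      intro i hi j hj hij
      rw [Finset.disjoint_left]
      intro x hx hy
      obtain ⟨u, hu, rfl⟩ := mem_arc.1 hx
      obtain ⟨v, hv, hvu⟩ := mem_arc.1 hy
      have hdvd : (N : ℤ) ∣ (b (p j) + v) - (b (p i) + u) := by
        rw [← ZMod.intCast_eq_intCast_iff_dvd_sub]
        push_cast
        exact hvu.symm
      have hstep : ∀ s t : ℤ, s < t → b s + k ≤ b t := fun s t hst => by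
        have h := hchain s (t - s).toNat
        rw [Int.toNat_of_nonneg (by omega), add_sub_cancel] at h
        nlinarith
      have h1 := hstep _ _ hij
      have h2 := hstep (p j) (p i + T.card * 1) (by have := hpm j hj; have := hp0 i hi; omega)
      rw [hbper] at h2
      have := Int.eq_zero_of_abs_lt_dvd hdvd (by rw [abs_lt]; omega)
      omega
    intro i hi j hj hij
    rcases lt_trichotomy (p i) (p j) with h | h | h
    · exact key i hi j hj h
    · exact absurd (by rw [← hpe i hi, h, hpe j hj]) hij
    · exact (key j hj i hi h).symm
  · obtain ⟨q, hq⟩ := hinj _ _ (hpe (e j₀) (heT j₀))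
    have : p (e j₀) = j₀ + T.card * q := by omega
    simp [this, hbper, hj₀, hca]
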